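/- arXiv:2206.05243 — 8 statements merged into one kernel-verified Lean document; each statement's English description precedes it below -/
import Mathlib

section
/- Exact 2-local decomposition of Pauli interactions (Lemma lem:exact-decomposition): There exists a universal constant C > 0 such that the following holds. Let k ≥ 1 and n ∈ ℕ with 2^(k−1) + 1 < n ≤ 2^k + 1, let σ : Fin n → Fin 4 define the Pauli string H = P(σ), and let t ∈ ℝ satisfy 8·|t|^(1/2^k) ≤ π/2. Then there exist m ∈ ℕ with m ≤ 4^k, 2-local Pauli strings H_1, …, H_m (each P(σ_j) with |support(σ_j)| ≤ 2), and reals t_1, …, t_m such that exp(i·t·H) = exp(i·t_m·H_m)⋯exp(i·t_1·H_1) and Σ_{j=1}^m |t_j| ≤ C·n²·|t|^(1/2^k). -/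
open scoped Matrix

/-- The four Pauli matrices `I, X, Y, Z`. -/
noncomputable def pauli : Fin 4 → Matrix (Fin 2) (Fin 2) ℂ :=
  ![1, !![0, 1; 1, 0], !![0, -Complex.I; Complex.I, 0], !![1, 0; 0, -1]]

/-- The Pauli string `P(σ) = ⊗ₖ P_{σ(k)}`, as a matrix indexed by `Fin n → Fin 2`. -/
noncomputable def pauliString {n : ℕ} (σ : Fin n → Fin 4) :
    Matrix (Fin n → Fin 2) (Fin n → Fin 2) ℂ :=
  Matrix.of fun x y => ∏ k, pauli (σ k) (x k) (y k)

section PauliAux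

theorem exp_invol {n : ℕ} (A : Matrix (Fin n → Fin 2) (Fin n → Fin 2) ℂ) (hA : A * A = 1) (z : ℂ) :
    NormedSpace.exp (z • A) = Complex.cosh z • (1 : Matrix (Fin n → Fin 2) (Fin n → Fin 2) ℂ)
      + Complex.sinh z • A := by
  let _ : NormedRing (Matrix (Fin n → Fin 2) (Fin n → Fin 2) ℂ) := Matrix.linftyOpNormedRing
  let _ : NormedAlgebra ℂ (Matrix (Fin n → Fin 2) (Fin n → Fin 2) ℂ) := Matrix.linftyOpNormedAlgebra
  have h1 := NormedSpace.exp_series_hasSum_exp' (𝕂 := ℂ) (z • A)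
  have e1 := NormedSpace.exp_series_hasSum_exp' (𝕂 := ℂ) (z : ℂ)
  have e2 := NormedSpace.exp_series_hasSum_exp' (𝕂 := ℂ) (-z : ℂ)
  rw [← Complex.exp_eq_exp_ℂ] at e1 e2
  have h2 := (e1.smul_const ((1/2 : ℂ) • (1 + A))).add (e2.smul_const ((1/2 : ℂ) • (1 - A)))
  have hp : ∀ m : ℕ, A ^ m = (1/2 : ℂ) • (1 + A) + ((-1) ^ m * (1/2 : ℂ)) • (1 - A) := by
    intro m
    induction m with
    | zero => rw [pow_zero]; module
    | succ m ih =>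
      rw [pow_succ, ih]
      simp only [add_mul, sub_mul, smul_mul_assoc, one_mul, hA]
      rw [pow_succ]
      module
  have h3 : NormedSpace.exp (z • A) = Complex.exp z • (1/2 : ℂ) • (1 + A)
      + Complex.exp (-z) • (1/2 : ℂ) • (1 - A) := by
    refine h1.unique (HasSum.congr_fun h2 fun m => ?_)
    rw [smul_pow, hp m]
    rw [neg_pow z m]
    simp only [smul_eq_mul]
    module
  rw [h3, Complex.cosh, Complex.sinh]
  module

theorem exp_invol' {n : ℕ} (A : Matrix (Fin n → Fin 2) (Fin n → Fin 2) ℂ) (hA : A * A = 1) (t : ℝ) :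
    NormedSpace.exp ((Complex.I * (t : ℂ)) • A) =
      (Real.cos t : ℂ) • (1 : Matrix (Fin n → Fin 2) (Fin n → Fin 2) ℂ)
      + (Complex.I * (Real.sin t : ℂ)) • A := by
  rw [exp_invol A hA, mul_comm Complex.I, Complex.cosh_mul_I, Complex.sinh_mul_I]
  push_cast
  rw [mul_comm Complex.I]

theorem angles (t : ℝ) (h0 : 0 ≤ t) (h1 : t ≤ 1/4) : ∃ a b : ℝ, |a| ≤ √t ∧ |b| ≤ √t ∧
    (let p := Real.cos a * Real.cos b
     let q := Real.sin a * Real.sin b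
     let u := Real.sin a * Real.cos b
     let v := Real.cos a * Real.sin b
     p^2 - q^2 + 2*p*q = Real.cos t ∧ 2*p*q + v^2 - u^2 = Real.sin t ∧ (v-u)*p = (u+v)*q) := by
  set w := Real.tan (t/2) with hw
  have hc : 5/6 ≤ Real.cos (t/2) := by
    have := Real.one_sub_sq_div_two_le_cos (x := t/2)
    nlinarith
  have hs0 : 0 ≤ Real.sin (t/2) :=
    Real.sin_nonneg_of_nonneg_of_le_pi (by linarith) (by linarith [Real.pi_gt_three])
  have hs1 : Real.sin (t/2) ≤ t/2 := Real.sin_le (by linarith)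
  have hsw : Real.sin (t/2) = w * Real.cos (t/2) := by
    rw [hw, Real.tan_mul_cos (by linarith)]
  have hw0 : 0 ≤ w := by
    by_contra h
    push Not at h
    nlinarith
  have hw1 : w ≤ 3/5 * t := by nlinarith
  have hw2 : w ≤ 3/20 := by linarith
  have hcs := Real.sin_sq_add_cos_sq (t/2)
  have hc2 : Real.cos (t/2)^2 = 1 / (1 + w^2) := by
    rw [hsw] at hcs
    field_simp
    linarith
  have hcost : Real.cos t = (1 - w^2)/(1+w^2) := by
    have : Real.cos t = 2 * Real.cos (t/2)^2 - 1 := by rw [← Real.cos_two_mul]; ring_nf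
    rw [this, hc2]; field_simp; ring
  have hsint : Real.sin t = 2*w/(1+w^2) := by
    have : Real.sin t = 2 * Real.sin (t/2) * Real.cos (t/2) := by rw [← Real.sin_two_mul]; ring_nf
    rw [this, hsw, show 2 * (w * Real.cos (t/2)) * Real.cos (t/2) = 2 * w * Real.cos (t/2)^2 by ring,
      hc2]; field_simp
  have e2 : 0 < 1 - w^2 := by nlinarith only [hw0, hw2]
  have e1 : 0 < 1 - w^2 + 2*w := by linarith
  set y := √(w*(1+w)/(1-w)) with hy
  have h1w : 0 < 1 - w := by linarith
  have h1w' : 0 < 1 + w := by linarith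
  have hy2 : y^2 = w*(1+w)/(1-w) := Real.sq_sqrt (by positivity)
  have hy0 : 0 ≤ y := Real.sqrt_nonneg _
  set x := y * ((1-w)/(1+w)) with hx
  have hx0 : 0 ≤ x := by positivity
  have hyt : y ≤ √t := by
    apply Real.sqrt_le_sqrt
    rw [div_le_iff₀ h1w]
    nlinarith
  have hxy : x ≤ y := by
    rw [hx]
    apply mul_le_of_le_one_right hy0
    rw [div_le_one h1w']; linarith
  have hx2 : x^2 = w*(1-w)/(1+w) := by
    rw [hx, mul_pow, hy2]; field_simp
  have hxyw : x * y = w := by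
    rw [hx, show y * ((1-w)/(1+w)) * y = y^2 * ((1-w)/(1+w)) by ring, hy2]; field_simp
  have harc : ∀ z : ℝ, 0 ≤ z → |Real.arctan z| ≤ z := by
    intro z hz
    have h : 0 ≤ Real.arctan z := Real.arctan_nonneg.2 hz
    rw [abs_of_nonneg h]
    have := Real.le_tan h (Real.arctan_lt_pi_div_two z)
    rwa [Real.tan_arctan] at this
  have hsc : ∀ z : ℝ, Real.sin (Real.arctan z) = z * Real.cos (Real.arctan z) := by
    intro z
    have := Real.tan_mul_cos (Real.cos_arctan_pos z).ne'
    rw [Real.tan_arctan] at this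
    exact this.symm
  refine ⟨Real.arctan x, Real.arctan y, (harc x hx0).trans (hxy.trans hyt),
    (harc y hy0).trans hyt, ?_⟩
  have hcx : Real.cos (Real.arctan x)^2 = 1/(1+x^2) := Real.cos_sq_arctan x
  have hcy : Real.cos (Real.arctan y)^2 = 1/(1+y^2) := Real.cos_sq_arctan y
  simp only [hsc]
  generalize Real.cos (Real.arctan x) = c at *
  generalize Real.cos (Real.arctan y) = d at *
  have hcd : c^2*d^2 = (1-w^2)/((1+w^2)*(1-w^2+2*w)) := by
    rw [hcx, hcy, hx2, hy2]
    field_simp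
    ring
  refine ⟨?_, ?_, ?_⟩
  · rw [hcost]
    calc _ = (c^2*d^2)*(1-(x*y)^2+2*(x*y)) := by ring
      _ = _ := by rw [hxyw, hcd]; field_simp
  · rw [hsint]
    calc _ = (c^2*d^2)*(2*(x*y)+y^2-x^2) := by ring
      _ = _ := by
        rw [hxyw, hcd, hx2, hy2]
        have : (1 - w^2) = (1-w)*(1+w) := by ring
        field_simp
        ring
  · calc _ = (c^2*d^2)*(y-x) := by ring
      _ = (c^2*d^2)*((x+y)*(x*y)) := by
        congr 1
        rw [hxyw, hx]
        field_simp
        ring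
      _ = _ := by ring

theorem comm_step {n : ℕ} (A B H : Matrix (Fin n → Fin 2) (Fin n → Fin 2) ℂ)
    (hA : A * A = 1) (hB : B * B = 1) (hH : H * H = 1)
    (hAB : A * B = Complex.I • H) (hBA : B * A = -(Complex.I • H))
    (t : ℝ) (h0 : 0 ≤ t) (h1 : t ≤ 1/4) : ∃ a b : ℝ, |a| ≤ √t ∧ |b| ≤ √t ∧
      NormedSpace.exp ((Complex.I * (t : ℂ)) • H) =
        NormedSpace.exp ((Complex.I * (a : ℂ)) • A) *
        (NormedSpace.exp ((Complex.I * ((-b : ℝ) : ℂ)) • B) *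
        (NormedSpace.exp ((Complex.I * ((-b : ℝ) : ℂ)) • A) *
        NormedSpace.exp ((Complex.I * (a : ℂ)) • B))) := by
  obtain ⟨a, b, ha, hb, h⟩ := angles t h0 h1
  refine ⟨a, b, ha, hb, ?_⟩
  simp only [exp_invol' _ hA, exp_invol' _ hB, exp_invol' _ hH, Real.cos_neg, Real.sin_neg]
  simp only at h
  obtain ⟨g1, g2, g3⟩ := h
  have hI : Complex.I * Complex.I = -1 := Complex.I_mul_I
  have hH' : H = -(Complex.I • (A * B)) := by
    rw [hAB, smul_smul, hI]; simp
  have hBA' : B * A = -(A*B) := by rw [hBA, hAB]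
  rw [← g1, ← g2, hH']
  generalize Real.cos a = ca at *
  generalize Real.cos b = cb at *
  generalize Real.sin a = sa at *
  generalize Real.sin b = sb at *
  have g3' : ((ca : ℂ) * sb - sa * cb) * (ca * cb) = (sa * cb + ca * sb) * (sa * sb) := by
    exact_mod_cast g3
  have r1 : ∀ M, A * (A * M) = M := fun M => by rw [← mul_assoc, hA, one_mul]
  have r2 : ∀ M, B * (B * M) = M := fun M => by rw [← mul_assoc, hB, one_mul]
  have r3 : ∀ M, B * (A * M) = -(A * (B * M)) := fun M => by
    rw [← mul_assoc, hBA', neg_mul, mul_assoc]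
  simp only [add_mul, mul_add, smul_mul_assoc, mul_smul_comm, one_mul, mul_one, r1, r2, r3, hA, hB,
    hBA', mul_neg, neg_neg, smul_neg, smul_add, smul_smul]
  push_cast
  match_scalars
  · linear_combination (2*ca*cb*sa*sb + ((sa:ℂ)*sb)^2*(Complex.I*Complex.I-1))*hI
  · ring
  · linear_combination Complex.I*g3' + Complex.I*((sa * cb + ca * sb) * (sa * sb))*hI
  · linear_combination Complex.I*g3' + Complex.I*((sa * cb + ca * sb) * (sa * sb))*hI

/-- tensor product of matrices -/
noncomputable def tens {n : ℕ} (M : Fin n → Matrix (Fin 2) (Fin 2) ℂ) :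
    Matrix (Fin n → Fin 2) (Fin n → Fin 2) ℂ :=
  Matrix.of fun x y => ∏ k, M k (x k) (y k)

theorem tens_mul {n : ℕ} (M N : Fin n → Matrix (Fin 2) (Fin 2) ℂ) :
    tens M * tens N = tens (fun k => M k * N k) := by
  ext x y
  simp only [tens, Matrix.mul_apply, Matrix.of_apply]
  rw [Finset.prod_univ_sum]
  simp only [Fintype.piFinset_univ, Finset.prod_mul_distrib]

theorem tens_one {n : ℕ} : tens (fun _ : Fin n => (1 : Matrix (Fin 2) (Fin 2) ℂ)) = 1 := by
  ext x y
  simp only [tens, Matrix.of_apply, Matrix.one_apply]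
  by_cases h : x = y
  · subst h; simp
  · rw [if_neg h]
    obtain ⟨k, hk⟩ := Function.ne_iff.1 h
    exact Finset.prod_eq_zero (Finset.mem_univ k) (by simp [hk])

theorem tens_smul {n : ℕ} (M : Fin n → Matrix (Fin 2) (Fin 2) ℂ) (c : Fin n → ℂ) :
    tens (fun k => c k • M k) = (∏ k, c k) • tens M := by
  ext x y
  simp [tens, Finset.prod_mul_distrib]

theorem pauliString_eq {n : ℕ} (σ : Fin n → Fin 4) : pauliString σ = tens (fun k => pauli (σ k)) := rfl

theorem pauli_sq (i : Fin 4) : pauli i * pauli i = 1 := by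
  fin_cases i <;> ext a b <;> fin_cases a <;> fin_cases b <;>
    simp [pauli, Matrix.mul_apply, Fin.sum_univ_two]

theorem pauli_zero : pauli 0 = 1 := rfl

theorem pauli_split (i : Fin 4) (hi : i ≠ 0) : ∃ a b : Fin 4,
    pauli a * pauli b = Complex.I • pauli i ∧ pauli b * pauli a = (-Complex.I) • pauli i := by
  have : i = 1 ∨ i = 2 ∨ i = 3 := by revert i; decide
  rcases this with rfl | rfl | rfl
  · refine ⟨2, 3, ?_, ?_⟩ <;> ext a b <;> fin_cases a <;> fin_cases b <;>
    simp [pauli, Matrix.mul_apply, Fin.sum_univ_two]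
  · refine ⟨3, 1, ?_, ?_⟩ <;> ext a b <;> fin_cases a <;> fin_cases b <;>
    simp [pauli, Matrix.mul_apply, Fin.sum_univ_two]
  · refine ⟨1, 2, ?_, ?_⟩ <;> ext a b <;> fin_cases a <;> fin_cases b <;>
    simp [pauli, Matrix.mul_apply, Fin.sum_univ_two]

theorem pauliString_sq {n : ℕ} (σ : Fin n → Fin 4) : pauliString σ * pauliString σ = 1 := by
  rw [pauliString_eq, tens_mul]
  simp only [pauli_sq, tens_one]

/-- support -/
def supp {n : ℕ} (σ : Fin n → Fin 4) : Finset (Fin n) := Finset.univ.filter fun i => σ i ≠ 0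

theorem string_split {n : ℕ} (σ : Fin n → Fin 4) (N : ℕ) (h0 : 0 < (supp σ).card)
    (hN : (supp σ).card ≤ 2 * N + 1) : ∃ α β : Fin n → Fin 4,
    (supp α).card ≤ N + 1 ∧ (supp β).card ≤ N + 1 ∧
    pauliString α * pauliString β = Complex.I • pauliString σ ∧
    pauliString β * pauliString α = -(Complex.I • pauliString σ) := by
  obtain ⟨p, hp⟩ := Finset.card_pos.1 h0
  have hp0 : σ p ≠ 0 := by simpa [supp] using hp
  have hc : ((supp σ).erase p).card = (supp σ).card - 1 := Finset.card_erase_of_mem hp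
  obtain ⟨S, hS, hSc⟩ := Finset.exists_subset_card_eq
    (s := (supp σ).erase p) (n := min N ((supp σ).erase p).card) (min_le_right _ _)
  obtain ⟨a, b, hab, hba⟩ := pauli_split (σ p) hp0
  have hpS : p ∉ S := fun h => by simpa using hS h
  refine ⟨fun i => if i = p then a else if i ∈ S then σ i else 0,
    fun i => if i = p then b else if i ∈ S then 0 else σ i, ?_, ?_, ?_, ?_⟩
  · calc _ ≤ (insert p S).card := by
          apply Finset.card_le_card
          intro i
          simp only [supp, Finset.mem_filter, Finset.mem_univ, true_and, Finset.mem_insert]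
          by_cases h : i = p <;> by_cases h' : i ∈ S <;> simp [h, h']
      _ ≤ S.card + 1 := Finset.card_insert_le _ _
      _ ≤ N + 1 := by omega
  · calc _ ≤ (insert p (((supp σ).erase p) \ S)).card := by
          apply Finset.card_le_card
          intro i
          simp only [supp, Finset.mem_filter, Finset.mem_univ, true_and, Finset.mem_insert,
            Finset.mem_sdiff, Finset.mem_erase]
          by_cases h : i = p <;> by_cases h' : i ∈ S <;> simp [h, h']
      _ ≤ (((supp σ).erase p) \ S).card + 1 := Finset.card_insert_le _ _
      _ ≤ N + 1 := by rw [Finset.card_sdiff_of_subset hS]; omega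
  · rw [pauliString_eq, pauliString_eq, pauliString_eq, tens_mul]
    have : (Complex.I : ℂ) = ∏ k : Fin n, (if k = p then Complex.I else 1) := by simp
    rw [this, ← tens_smul]
    congr 1
    funext k
    by_cases h : k = p
    · subst h; simp [hab]
    · by_cases h' : k ∈ S <;> simp [h, h', pauli_zero]
  · rw [pauliString_eq, pauliString_eq, pauliString_eq, tens_mul, ← neg_smul]
    have : (-Complex.I : ℂ) = ∏ k : Fin n, (if k = p then -Complex.I else 1) := by simp
    rw [this, ← tens_smul]
    congr 1
    funext k
    by_cases h : k = p
    · subst h; simp [hba]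
    · by_cases h' : k ∈ S <;> simp [h, h', pauli_zero]

/-- a gate -/
noncomputable def gate {n : ℕ} (g : (Fin n → Fin 4) × ℝ) :
    Matrix (Fin n → Fin 2) (Fin n → Fin 2) ℂ :=
  NormedSpace.exp ((Complex.I * (g.2 : ℂ)) • pauliString g.1)

theorem step {n : ℕ} (σ α β : Fin n → Fin 4)
    (h1 : pauliString α * pauliString β = Complex.I • pauliString σ)
    (h2 : pauliString β * pauliString α = -(Complex.I • pauliString σ))
    (t : ℝ) (ht : |t| ≤ 1/4) : ∃ (α' β' : Fin n → Fin 4) (a b : ℝ),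
      (α' = α ∧ β' = β ∨ α' = β ∧ β' = α) ∧ |a| ≤ √|t| ∧ |b| ≤ √|t| ∧
      gate (σ, t) = gate (α', a) * (gate (β', b) * (gate (α', b) * gate (β', a))) := by
  rcases le_total 0 t with h | h
  · rw [abs_of_nonneg h] at ht ⊢
    obtain ⟨a, b, ha, hb, e⟩ := comm_step _ _ _ (pauliString_sq α) (pauliString_sq β)
      (pauliString_sq σ) h1 h2 t h ht
    exact ⟨α, β, a, -b, Or.inl ⟨rfl, rfl⟩, ha, by rwa [abs_neg], e⟩
  · rw [abs_of_nonpos h] at ht ⊢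
    obtain ⟨a, b, ha, hb, e⟩ := comm_step (pauliString β) (pauliString α) (-pauliString σ)
      (pauliString_sq β) (pauliString_sq α)
      (by rw [neg_mul_neg, pauliString_sq]) (by rw [h2, smul_neg]) (by rw [h1, smul_neg, neg_neg])
      (-t) (by linarith) ht
    refine ⟨β, α, a, -b, Or.inr ⟨rfl, rfl⟩, ha, by rwa [abs_neg], ?_⟩
    unfold gate
    simp only
    rw [← e]
    congr 1
    push_cast
    simp

theorem main_ind {n : ℕ} (k : ℕ) : ∀ (σ : Fin n → Fin 4) (t r : ℝ), 0 ≤ r → r ≤ 1/4 →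
    |t| ≤ r ^ (2^k) → (supp σ).card ≤ 2^k + 1 →
    ∃ L : List ((Fin n → Fin 4) × ℝ), L.length ≤ 4^k ∧ (∀ g ∈ L, (supp g.1).card ≤ 2) ∧
      gate (σ, t) = (L.map gate).prod ∧ (L.map fun g => |g.2|).sum ≤ 4^k * r := by
  induction k with
  | zero =>
    intro σ t r h0 h1 ht hs
    exact ⟨[(σ, t)], by simp, by simpa using hs, by simp, by simpa using ht⟩
  | succ k ih =>
    intro σ t r h0 h1 ht hs
    have htr : |t| ≤ r := ht.trans (pow_le_of_le_one h0 (by linarith) (by positivity))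
    rcases Nat.eq_zero_or_pos (supp σ).card with hz | hz
    · refine ⟨[(σ, t)], ?_, by simp [hz], by simp, ?_⟩
      · simpa using Nat.one_le_pow _ _ (by norm_num)
      · have : (1:ℝ) ≤ 4^(k+1) := one_le_pow₀ (by norm_num)
        simp only [List.map_cons, List.map_nil, List.sum_cons, List.sum_nil, add_zero]
        nlinarith
    obtain ⟨α, β, hα, hβ, e1, e2⟩ := string_split σ (2^k) hz (by rw [pow_succ] at hs; omega)
    obtain ⟨α', β', a, b, hor, ha, hb, e⟩ := step σ α β e1 e2 t (by linarith)
    have hsq : √|t| ≤ r^(2^k) := by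
      apply Real.sqrt_le_iff.2 ⟨by positivity, ?_⟩
      rwa [← pow_mul, ← pow_succ]
    have hα' : (supp α').card ≤ 2^k+1 := by rcases hor with ⟨rfl, rfl⟩ | ⟨rfl, rfl⟩ <;> assumption
    have hβ' : (supp β').card ≤ 2^k+1 := by rcases hor with ⟨rfl, rfl⟩ | ⟨rfl, rfl⟩ <;> assumption
    obtain ⟨L1, l1, m1, p1, s1⟩ := ih α' a r h0 h1 (ha.trans hsq) hα'
    obtain ⟨L2, l2, m2, p2, s2⟩ := ih β' b r h0 h1 (hb.trans hsq) hβ'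
    obtain ⟨L3, l3, m3, p3, s3⟩ := ih α' b r h0 h1 (hb.trans hsq) hα'
    obtain ⟨L4, l4, m4, p4, s4⟩ := ih β' a r h0 h1 (ha.trans hsq) hβ'
    refine ⟨L1 ++ (L2 ++ (L3 ++ L4)), ?_, ?_, ?_, ?_⟩
    · simp only [List.length_append, pow_succ]; omega
    · intro g hg
      simp only [List.mem_append] at hg
      rcases hg with h | h | h | h
      · exact m1 g h
      · exact m2 g h
      · exact m3 g h
      · exact m4 g h
    · simp only [List.map_append, List.prod_append]
      rw [e, p1, p2, p3, p4]
    · simp only [List.map_append, List.sum_append, pow_succ]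
      linarith

end PauliAux

/-- **Exact 2-local decomposition of Pauli interactions** (Lemma `lem:exact-decomposition`). -/
theorem exact_pauli_decomposition :
    ∃ C : ℝ, 0 < C ∧
      ∀ (k n : ℕ), 1 ≤ k → 2 ^ (k - 1) + 1 < n → n ≤ 2 ^ k + 1 →
        ∀ (σ : Fin n → Fin 4) (t : ℝ),
          8 * |t| ^ ((1 : ℝ) / 2 ^ k) ≤ Real.pi / 2 →
            ∃ m : ℕ, m ≤ 4 ^ k ∧
              ∃ (σs : Fin m → Fin n → Fin 4) (ts : Fin m → ℝ),
                (∀ j, (Finset.univ.filter fun i => σs j i ≠ 0).card ≤ 2) ∧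
                NormedSpace.exp ((Complex.I * (t : ℂ)) • pauliString σ) =
                  ((List.ofFn fun j : Fin m =>
                    NormedSpace.exp ((Complex.I * (ts j : ℂ)) • pauliString (σs j))).reverse).prod ∧
                (∑ j, |ts j|) ≤ C * (n : ℝ) ^ 2 * |t| ^ ((1 : ℝ) / 2 ^ k) := by
  refine ⟨4, by norm_num, ?_⟩
  intro k n hk hn1 hn2 σ t ht
  set r := |t| ^ ((1 : ℝ) / 2 ^ k) with hr
  have hr0 : 0 ≤ r := by positivity
  have hr1 : r ≤ 1/4 := by linarith [Real.pi_lt_four]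
  have hrt : |t| ≤ r ^ (2^k) := by
    rw [hr, ← Real.rpow_natCast, ← Real.rpow_mul (abs_nonneg t)]
    push_cast
    rw [one_div, inv_mul_cancel₀ (by positivity), Real.rpow_one]
  obtain ⟨L, hl, hm, hp, hs⟩ := main_ind k σ t r hr0 hr1 hrt
    (((Finset.card_le_univ _).trans (by simp)).trans hn2)
  refine ⟨L.reverse.length, by simpa using hl, fun j => (L.reverse.get j).1,
    fun j => (L.reverse.get j).2, ?_, ?_, ?_⟩
  · intro j
    exact hm _ (List.mem_reverse.1 (List.get_mem _ _))
  · have : (List.ofFn fun j : Fin L.reverse.length =>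
        NormedSpace.exp ((Complex.I * ((L.reverse.get j).2 : ℂ)) • pauliString (L.reverse.get j).1))
        = L.reverse.map gate := by
      conv_rhs => rw [← List.ofFn_get L.reverse, List.map_ofFn]
      rfl
    rw [this, List.map_reverse, List.reverse_reverse, ← hp]
    rfl
  · have : ∑ j, |(L.reverse.get j).2| = (L.map fun g => |g.2|).sum := by
      rw [← List.sum_ofFn, ← List.sum_reverse (L.map _), ← List.map_reverse]
      conv_rhs => rw [← List.ofFn_get L.reverse, List.map_ofFn]
      rfl
    rw [this]
    refine hs.trans (mul_le_mul_of_nonneg_right ?_ hr0)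
    have h2 : 2^k ≤ 2*n := by
      obtain ⟨j, rfl⟩ : ∃ j, k = j + 1 := ⟨k-1, by omega⟩
      simp only [Nat.add_sub_cancel] at hn1
      rw [pow_succ]; omega
    have h2' : (2:ℝ)^k ≤ 2*n := by exact_mod_cast h2
    calc (4:ℝ)^k = (2^k)^2 := by rw [← pow_mul, mul_comm, pow_mul]; norm_num
      _ ≤ (2*n)^2 := by gcongr
      _ = _ := by ring
end

section
/- First-order Suzuki/Trotter product formula with explicit error (Lemma lem:custom-suzuki): There exists a universal constant C > 0 such that for all d, m, s ∈ ℕ with d, m, s ≥ 1 and all d×d Hermitian matrices H_1, …, H_m with Σ_{j=1}^m ‖H_j‖ ≤ t ≤ 1, letting H := Σ_{j=1}^m H_j, one has ‖exp(iH) − (Π_{j=1}^m exp(i·H_j/s))^s‖ ≤ C·t²/s. -/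
open scoped Matrix Matrix.Norms.L2Operator

section Aux
variable {A : Type*} [NormedRing A] [NormedAlgebra ℂ A] [NormOneClass A] [CompleteSpace A]

theorem aux_hs (x : A) : HasSum (fun n : ℕ => ((n.factorial : ℂ)⁻¹) • x ^ n) (NormedSpace.exp x) :=
  NormedSpace.exp_series_hasSum_exp' (𝕂 := ℂ) x

theorem aux_term (x : A) (n : ℕ) : ‖((n.factorial : ℂ)⁻¹) • x ^ n‖ ≤ ((n.factorial : ℝ)⁻¹) • ‖x‖ ^ n := by
  rw [norm_smul, smul_eq_mul, norm_inv, Complex.norm_natCast]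
  gcongr
  exact norm_pow_le x n

theorem aux_hsr (r : ℝ) : HasSum (fun n : ℕ => ((n.factorial : ℝ)⁻¹) • r ^ n) (Real.exp r) := by
  rw [Real.exp_eq_exp_ℝ]
  exact NormedSpace.exp_series_hasSum_exp' (𝕂 := ℝ) r

theorem aux_exp (x : A) : ‖NormedSpace.exp x‖ ≤ Real.exp ‖x‖ := by
  rw [← (aux_hs x).tsum_eq]
  exact tsum_of_norm_bounded (aux_hsr ‖x‖) (aux_term x)

theorem aux_exp2 (x : A) : ‖NormedSpace.exp x - 1 - x‖ ≤ Real.exp ‖x‖ - 1 - ‖x‖ := by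
  have h1 := (hasSum_nat_add_iff' 2).2 (aux_hs x)
  have h2 := (hasSum_nat_add_iff' 2).2 (aux_hsr ‖x‖)
  simp only [Finset.sum_range_succ, Finset.sum_range_zero] at h1 h2
  have := tsum_of_norm_bounded h2 (fun n => aux_term x (n + 2))
  rw [h1.tsum_eq] at this
  simpa [sub_sub] using this

theorem aux_list (l : List A) :
    ‖l.sum‖ ≤ (l.map norm).sum ∧
    ‖(l.map NormedSpace.exp).prod‖ ≤ Real.exp (l.map norm).sum ∧
    ‖(l.map NormedSpace.exp).prod - 1 - l.sum‖ ≤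
      Real.exp (l.map norm).sum - 1 - (l.map norm).sum := by
  induction l with
  | nil => simp
  | cons a l ih =>
    obtain ⟨h0, h1, h2⟩ := ih
    simp only [List.map_cons, List.prod_cons, List.sum_cons]
    set P := (l.map NormedSpace.exp).prod
    set S := l.sum
    set τ := (l.map norm).sum
    refine ⟨(norm_add_le _ _).trans (by gcongr), ?_, ?_⟩
    · rw [Real.exp_add]
      exact (norm_mul_le _ _).trans (mul_le_mul (aux_exp a) h1 (norm_nonneg _) (Real.exp_pos _).le)
    · have e : NormedSpace.exp a * P - 1 - (a + S) =
          (NormedSpace.exp a - 1 - a) * P + (1 + a) * (P - 1 - S) + a * S := by noncomm_ring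
      have k1 : ‖(NormedSpace.exp a - 1 - a) * P‖ ≤ (Real.exp ‖a‖ - 1 - ‖a‖) * Real.exp τ :=
        (norm_mul_le _ _).trans (mul_le_mul (aux_exp2 a) h1 (norm_nonneg _)
          ((norm_nonneg _).trans (aux_exp2 a)))
      have k0 : ‖(1 : A) + a‖ ≤ 1 + ‖a‖ := by simpa using norm_add_le (1 : A) a
      have k2 : ‖(1 + a) * (P - 1 - S)‖ ≤ (1 + ‖a‖) * (Real.exp τ - 1 - τ) :=
        (norm_mul_le _ _).trans (mul_le_mul k0 h2 (norm_nonneg _) (by positivity))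
      have k3 : ‖a * S‖ ≤ ‖a‖ * τ :=
        (norm_mul_le _ _).trans (mul_le_mul_of_nonneg_left h0 (norm_nonneg _))
      rw [e, Real.exp_add]
      refine (norm_add₃_le).trans ?_
      linarith

omit [NormedAlgebra ℂ A] [CompleteSpace A] in
theorem aux_pow (X Y : A) (M : ℝ) (hM : 1 ≤ M) (hX : ‖X‖ ≤ M) (hY : ‖Y‖ ≤ M) (s : ℕ) :
    ‖X ^ s - Y ^ s‖ ≤ s * M ^ s * ‖X - Y‖ := by
  induction s with
  | zero => simp
  | succ n ih =>
    have e : X ^ (n+1) - Y ^ (n+1) = (X ^ n - Y ^ n) * X + Y ^ n * (X - Y) := by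
      rw [pow_succ, pow_succ]; noncomm_ring
    have hM0 : 0 ≤ M := by linarith
    have k1 : ‖(X ^ n - Y ^ n) * X‖ ≤ (n * M ^ n * ‖X - Y‖) * M :=
      (norm_mul_le _ _).trans (mul_le_mul ih hX (norm_nonneg _) (by positivity))
    have k2 : ‖Y ^ n * (X - Y)‖ ≤ M ^ (n+1) * ‖X - Y‖ := by
      refine (norm_mul_le _ _).trans ?_
      gcongr
      calc ‖Y ^ n‖ ≤ ‖Y‖ ^ n := norm_pow_le _ _
        _ ≤ M ^ n := by gcongr
        _ ≤ M ^ (n+1) := pow_le_pow_right₀ hM (Nat.le_succ n)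
    rw [e]
    refine (norm_add_le _ _).trans ((add_le_add k1 k2).trans (le_of_eq ?_))
    push_cast; ring

theorem aux_main (l : List A) (s : ℕ) (hs : 1 ≤ s) (t : ℝ) (ht : (l.map norm).sum ≤ t / s)
    (ht1 : t ≤ 1) :
    ‖NormedSpace.exp ((s : ℂ) • l.sum) - (l.map NormedSpace.exp).prod ^ s‖ ≤ 6 * t ^ 2 / s := by
  obtain ⟨h0, h1, h2⟩ := aux_list l
  set P := (l.map NormedSpace.exp).prod
  set S := l.sum
  set τ := (l.map norm).sum
  have hs0 : (1 : ℝ) ≤ s := by exact_mod_cast hs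
  have hsp : (0 : ℝ) < s := by linarith
  have hτ0 : 0 ≤ τ := (norm_nonneg _).trans h0
  have hst : s * τ ≤ t := by rw [le_div_iff₀ hsp] at ht; linarith
  have hτ1 : τ ≤ 1 := by nlinarith
  have hq : Real.exp τ - 1 - τ ≤ τ ^ 2 :=
    (le_abs_self _).trans (Real.abs_exp_sub_one_sub_id_le (by rwa [abs_of_nonneg hτ0]))
  have hE : ‖NormedSpace.exp S - 1 - S‖ ≤ τ ^ 2 := by
    refine (aux_exp2 S).trans ?_
    refine (le_abs_self _).trans ((Real.abs_exp_sub_one_sub_id_le ?_).trans ?_)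
    · rw [abs_of_nonneg (norm_nonneg _)]; linarith
    · gcongr
  have hEP : ‖NormedSpace.exp S - P‖ ≤ 2 * τ ^ 2 := by
    have e : NormedSpace.exp S - P = (NormedSpace.exp S - 1 - S) - (P - 1 - S) := by abel
    rw [e]
    refine (norm_sub_le _ _).trans ?_
    linarith
  have hpow : NormedSpace.exp ((s : ℂ) • S) = NormedSpace.exp S ^ s := by
    let _ : NormedAlgebra ℚ A := NormedAlgebra.restrictScalars ℚ ℂ A
    rw [Nat.cast_smul_eq_nsmul, NormedSpace.exp_nsmul]
  rw [hpow]
  have hM := aux_pow (NormedSpace.exp S) P (Real.exp τ) (Real.one_le_exp hτ0)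
    ((aux_exp S).trans (Real.exp_le_exp.2 h0)) h1 s
  have hM3 : Real.exp τ ^ s ≤ 3 := by
    rw [← Real.exp_nat_mul]
    have := Real.exp_le_exp.2 (hst.trans ht1)
    have := Real.exp_one_lt_d9
    linarith
  have hτs : τ ^ 2 ≤ (t / s) ^ 2 := by gcongr
  calc _ ≤ _ := hM
    _ ≤ s * 3 * (2 * (t / s) ^ 2) := by
        gcongr
        linarith
    _ = 6 * t ^ 2 / s := by field_simp; ring

end Aux

/-- **First-order Suzuki/Trotter product formula with explicit error**
(Lemma `lem:custom-suzuki`). -/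
theorem suzuki_trotter_first_order :
    ∃ C : ℝ, 0 < C ∧
      ∀ (d m s : ℕ), 1 ≤ d → 1 ≤ m → 1 ≤ s →
        ∀ (H : Fin m → Matrix (Fin d) (Fin d) ℂ), (∀ j, (H j).IsHermitian) →
          ∀ t : ℝ, (∑ j, ‖H j‖) ≤ t → t ≤ 1 →
            ‖NormedSpace.exp (Complex.I • ∑ j, H j) -
              ((List.ofFn fun j : Fin m =>
                NormedSpace.exp ((Complex.I / (s : ℂ)) • H j)).prod) ^ s‖ ≤
              C * t ^ 2 / (s : ℝ) := by
  refine ⟨6, by norm_num, ?_⟩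
  intro d m s hd hm hs H _ t ht ht1
  haveI : Nonempty (Fin d) := ⟨⟨0, hd⟩⟩
  have hsp : (0 : ℝ) < s := by exact_mod_cast hs
  have hsc : (s : ℂ) ≠ 0 := by exact_mod_cast hsp.ne'
  have key := aux_main (List.ofFn fun j : Fin m => (Complex.I / (s : ℂ)) • H j) s hs t (by
    rw [List.map_ofFn, List.sum_ofFn, le_div_iff₀ hsp, Finset.sum_mul]
    refine le_trans (Finset.sum_le_sum fun j _ => ?_) ht
    simp only [Function.comp, norm_smul, norm_div, Complex.norm_I, Complex.norm_natCast]
    apply le_of_eq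
    field_simp) ht1
  rw [List.map_ofFn, List.sum_ofFn, ← Finset.smul_sum, smul_smul, mul_div_cancel₀ _ hsc] at key
  exact key
end

section
/- Fooling the FLUX gadget (Lemma l:right): Let U, V be 2×2 unitary matrices and suppose there exist unit vectors γ₁, γ₂ ∈ ℂ² such that V†U γ₁ = γ₁, V U† γ₂ = γ₂, and U γ₁ = γ₂. Then there exists a nonzero vector η ∈ ℂ² ⊗ ℂ² (concretely η = γ₁ ⊗ e₀ + γ₂ ⊗ e₁) such that for all a, b ∈ ℝ, (a·h(V) + b·h(U))·η = 0. -/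
open scoped Matrix Kronecker ComplexOrder

/-- Euclidean norm of a complex vector. -/
noncomputable def enorm {I : Type*} [Fintype I] (u : I → ℂ) : ℝ :=
  Real.sqrt (∑ i, ‖u i‖ ^ 2)

/-- Standard Hermitian inner product, conjugate-linear in the first argument. -/
noncomputable def ip {I : Type*} [Fintype I] (u v : I → ℂ) : ℂ :=
  ∑ i, (starRingEnd ℂ) (u i) * v i

/-- The matrix unit `E₁₀ = |1⟩⟨0|`. -/
noncomputable def E10 : Matrix (Fin 2) (Fin 2) ℂ := Matrix.single 1 0 1

/-- The matrix unit `E₀₁ = |0⟩⟨1|`. -/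
noncomputable def E01 : Matrix (Fin 2) (Fin 2) ℂ := Matrix.single 0 1 1

/-- The clock-restricted Feynman–Kitaev propagation term
`h(W) := I₄ − W ⊗ E₁₀ − W† ⊗ E₀₁` on `ℂ² ⊗ ℂ² ≅ ℂ⁴`. -/
noncomputable def fluxH (W : Matrix (Fin 2) (Fin 2) ℂ) :
    Matrix (Fin 2 × Fin 2) (Fin 2 × Fin 2) ℂ :=
  1 - W ⊗ₖ E10 - Wᴴ ⊗ₖ E01

/-- The Pauli matrix `X`. -/
noncomputable def pauliX : Matrix (Fin 2) (Fin 2) ℂ := !![0, 1; 1, 0]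

theorem fluxH_aux (W : Matrix (Fin 2) (Fin 2) ℂ) (γ₁ γ₂ : Fin 2 → ℂ)
    (h : W.mulVec γ₁ = γ₂) (h' : Wᴴ.mulVec γ₂ = γ₁) :
    (fluxH W).mulVec (fun p => γ₁ p.1 * (if p.2 = 0 then 1 else 0) +
                    γ₂ p.1 * (if p.2 = 1 then 1 else 0)) = 0 := by
  have a0 := congrFun h 0
  have a1 := congrFun h 1
  have b0 := congrFun h' 0
  have b1 := congrFun h' 1
  simp [Matrix.mulVec, dotProduct, Fin.sum_univ_two] at a0 a1 b0 b1
  ext ⟨i, j⟩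
  fin_cases i <;> fin_cases j <;>
    simp [fluxH, E10, E01, Matrix.mulVec, dotProduct, Fintype.sum_prod_type, Fin.sum_univ_two,
      Matrix.sub_apply, Matrix.one_apply, Matrix.single_apply]
  · linear_combination -b0
  · linear_combination -a0
  · linear_combination -b1
  · linear_combination -a1

/-- **Fooling the FLUX gadget** (Lemma `l:right`). -/
theorem fooling_flux_gadget (U V : Matrix (Fin 2) (Fin 2) ℂ)
    (hU : Uᴴ * U = 1 ∧ U * Uᴴ = 1) (hV : Vᴴ * V = 1 ∧ V * Vᴴ = 1)
    (γ₁ γ₂ : Fin 2 → ℂ) (hγ₁ : _root_.enorm γ₁ = 1) (hγ₂ : _root_.enorm γ₂ = 1)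
    (h1 : (Vᴴ * U).mulVec γ₁ = γ₁)
    (h2 : (V * Uᴴ).mulVec γ₂ = γ₂)
    (h3 : U.mulVec γ₁ = γ₂) :
    ∃ η : Fin 2 × Fin 2 → ℂ, η ≠ 0 ∧
      (η = fun p => γ₁ p.1 * (if p.2 = 0 then 1 else 0) +
                    γ₂ p.1 * (if p.2 = 1 then 1 else 0)) ∧
      ∀ a b : ℝ,
        ((a : ℂ) • fluxH V + (b : ℂ) • fluxH U).mulVec η = 0 := by
  have hv : V.mulVec γ₁ = γ₂ := by
    have h := congrArg V.mulVec h1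
    rw [Matrix.mulVec_mulVec, ← Matrix.mul_assoc, hV.2, Matrix.one_mul, h3] at h
    exact h.symm
  have hu' : Uᴴ.mulVec γ₂ = γ₁ := by
    rw [← h3, Matrix.mulVec_mulVec, hU.1, Matrix.one_mulVec]
  have hv' : Vᴴ.mulVec γ₂ = γ₁ := by
    rw [← hv, Matrix.mulVec_mulVec, hV.1, Matrix.one_mulVec]
  refine ⟨_, ?_, rfl, ?_⟩
  · intro h0
    have hz : γ₁ = 0 := by
      ext i
      simpa using congrFun h0 (i, 0)
    simp [hz, _root_.enorm] at hγ₁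
  · intro a b
    rw [Matrix.add_mulVec, Matrix.smul_mulVec, Matrix.smul_mulVec,
      fluxH_aux V γ₁ γ₂ hv hv', fluxH_aux U γ₁ γ₂ h3 hu']
    simp
end

section
/- Energy lower bound for the FLUX gadget with U = I and V = iX (Lemma l:complement): For every unit vector ψ ∈ ℂ² ⊗ ℂ² ≅ ℂ⁴, ⟨ψ, (h(I) + h(iX)) ψ⟩ ≥ 2 − √2, where X is the Pauli matrix [[0,1],[1,0]]. -/
open scoped Matrix Kronecker ComplexOrder

/-- **Energy lower bound for the FLUX gadget with `U = I` and `V = iX`**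
(Lemma `l:complement`). -/
theorem flux_energy_lower_bound (ψ : Fin 2 × Fin 2 → ℂ) (hψ : _root_.enorm ψ = 1) :
    2 - Real.sqrt 2 ≤
      (ip ψ ((fluxH 1 + fluxH (Complex.I • pauliX)).mulVec ψ)).re := by
  have hn : ∑ i, ‖ψ i‖ ^ 2 = 1 := by
    have h := hψ
    unfold _root_.enorm at h
    exact Real.sqrt_eq_one.mp h
  have hs : Real.sqrt 2 ^ 2 = 2 := Real.sq_sqrt (by norm_num)
  have hs0 : 0 ≤ Real.sqrt 2 := Real.sqrt_nonneg 2
  generalize Real.sqrt 2 = s at hs hs0 ⊢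
  simp only [Fintype.sum_prod_type, Fin.sum_univ_two, Complex.sq_norm, Complex.normSq_apply] at hn
  have key : (ip ψ ((fluxH 1 + fluxH (Complex.I • pauliX)).mulVec ψ)).re =
      2 * (((ψ (0, 0)).re * (ψ (0, 0)).re + (ψ (0, 0)).im * (ψ (0, 0)).im
        + ((ψ (0, 1)).re * (ψ (0, 1)).re + (ψ (0, 1)).im * (ψ (0, 1)).im))
        + ((ψ (1, 0)).re * (ψ (1, 0)).re + (ψ (1, 0)).im * (ψ (1, 0)).im
        + ((ψ (1, 1)).re * (ψ (1, 1)).re + (ψ (1, 1)).im * (ψ (1, 1)).im)))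
      - 2 * ((ψ (0, 1)).re * ((ψ (0, 0)).re - (ψ (1, 0)).im)
        + (ψ (0, 1)).im * ((ψ (0, 0)).im + (ψ (1, 0)).re)
        + (ψ (1, 1)).re * ((ψ (1, 0)).re - (ψ (0, 0)).im)
        + (ψ (1, 1)).im * ((ψ (1, 0)).im + (ψ (0, 0)).re)) := by
    simp [ip, fluxH, pauliX, E10, E01, Matrix.mulVec, dotProduct, Fintype.sum_prod_type,
      Fin.sum_univ_two, Matrix.single_apply, Matrix.one_apply]
    ring
  rw [key, hn]
  generalize (ψ (0, 0)).re = a at *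
  generalize (ψ (0, 0)).im = a' at *
  generalize (ψ (1, 0)).re = b at *
  generalize (ψ (1, 0)).im = b' at *
  generalize (ψ (0, 1)).re = c at *
  generalize (ψ (0, 1)).im = c' at *
  generalize (ψ (1, 1)).re = d at *
  generalize (ψ (1, 1)).im = d' at *
  have hP : 0 ≤ s / 2 * ((s * c - (a - b')) ^ 2 + (s * c' - (a' + b)) ^ 2
      + (s * d - (b - a')) ^ 2 + (s * d' - (b' + a)) ^ 2) := by positivity
  have e : s / 2 * ((s * c - (a - b')) ^ 2 + (s * c' - (a' + b)) ^ 2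
      + (s * d - (b - a')) ^ 2 + (s * d' - (b' + a)) ^ 2)
      = s - 2 * (c * (a - b') + c' * (a' + b) + d * (b - a') + d' * (b' + a)) := by
    linear_combination (s / 2 * (c^2 + c'^2 + d^2 + d'^2)
      - (c * (a - b') + c' * (a' + b) + d * (b - a') + d' * (b' + a))) * hs + s * hn
  linarith
end

section
/- Minimum eigenvalue of the residual FLUX operator (Equation eqn:evals): For all reals a, b ≥ 0, the Hermitian operator G(a,b) := a·h(iX) + b·h(I) on ℂ² ⊗ ℂ² ≅ ℂ⁴ has minimum eigenvalue exactly a + b − √(a² + b²), where X is the Pauli matrix [[0,1],[1,0]]. -/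
open scoped Matrix Kronecker ComplexOrder

theorem flux_aux_mulVec (a b : ℝ) (v : Fin 2 × Fin 2 → ℂ) :
    ((a : ℂ) • fluxH (Complex.I • pauliX) + (b : ℂ) • fluxH 1).mulVec v =
      fun p => if p = (0, 0) then (a + b) * v (0, 0) - (b * v (0, 1) - a * Complex.I * v (1, 1))
        else if p = (1, 0) then (a + b) * v (1, 0) - (b * v (1, 1) - a * Complex.I * v (0, 1))
        else if p = (0, 1) then (a + b) * v (0, 1) - (b * v (0, 0) + a * Complex.I * v (1, 0))
        else (a + b) * v (1, 1) - (b * v (1, 0) + a * Complex.I * v (0, 0)) := by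
  funext ⟨i, j⟩
  fin_cases i <;> fin_cases j <;>
    simp [Matrix.mulVec, dotProduct, Fintype.sum_prod_type, fluxH, E10, E01, pauliX,
      Matrix.one_apply, Matrix.single_apply] <;> ring

theorem flux_aux_real (a b s x y z w x' y' z' w' : ℝ) (hs : 0 ≤ s) (h : s ^ 2 = a ^ 2 + b ^ 2) :
    2 * (z * (b * x - a * y') + z' * (b * x' + a * y) + w * (b * y - a * x')
      + w' * (b * y' + a * x)) ≤
      s * (x ^ 2 + x' ^ 2 + y ^ 2 + y' ^ 2 + z ^ 2 + z' ^ 2 + w ^ 2 + w' ^ 2) := by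
  rcases hs.eq_or_lt with h0 | h0
  · have ha : a = 0 := by nlinarith [sq_nonneg a, sq_nonneg b]
    have hb : b = 0 := by nlinarith [sq_nonneg a, sq_nonneg b]
    subst ha hb
    rw [← h0]; simp
  · refine le_of_mul_le_mul_left ?_ h0
    have := add_nonneg (add_nonneg (sq_nonneg (s * z - (b * x - a * y')))
      (sq_nonneg (s * z' - (b * x' + a * y)))) (add_nonneg (sq_nonneg (s * w - (b * y - a * x')))
      (sq_nonneg (s * w' - (b * y' + a * x))))
    linear_combination this - (x ^ 2 + x' ^ 2 + y ^ 2 + y' ^ 2) * h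

/-- **Minimum eigenvalue of the residual FLUX operator** (Equation `eqn:evals`):
`G(a,b) := a·h(iX) + b·h(I)` has minimum eigenvalue exactly `a + b − √(a² + b²)`,
stated as: the Rayleigh quotient is bounded below by this value, and the value is
attained as an eigenvalue. -/
theorem flux_min_eigenvalue (a b : ℝ) (ha : 0 ≤ a) (hb : 0 ≤ b) :
    (∀ v : Fin 2 × Fin 2 → ℂ,
      (a + b - Real.sqrt (a ^ 2 + b ^ 2)) * _root_.enorm v ^ 2 ≤
        (ip v (((a : ℂ) • fluxH (Complex.I • pauliX) + (b : ℂ) • fluxH 1).mulVec v)).re) ∧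
    ∃ v : Fin 2 × Fin 2 → ℂ, v ≠ 0 ∧
      ((a : ℂ) • fluxH (Complex.I • pauliX) + (b : ℂ) • fluxH 1).mulVec v =
        ((a + b - Real.sqrt (a ^ 2 + b ^ 2) : ℝ) : ℂ) • v := by
  have hs := Real.sqrt_nonneg (a ^ 2 + b ^ 2)
  have h := Real.sq_sqrt (show 0 ≤ a ^ 2 + b ^ 2 by positivity)
  generalize Real.sqrt (a ^ 2 + b ^ 2) = s at hs h ⊢
  refine ⟨fun v => ?_, ?_⟩
  · rw [flux_aux_mulVec]
    unfold _root_.enorm ip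
    rw [Real.sq_sqrt (Finset.sum_nonneg fun i _ => sq_nonneg _)]
    have key := flux_aux_real a b s (v (0, 0)).re (v (1, 0)).re (v (0, 1)).re (v (1, 1)).re
      (v (0, 0)).im (v (1, 0)).im (v (0, 1)).im (v (1, 1)).im hs h
    simp only [Fintype.sum_prod_type, Fin.sum_univ_two, Complex.sq_norm, Complex.normSq_apply]
    simp
    linear_combination key
  · rcases hs.eq_or_lt with h0 | h0
    · have ha : a = 0 := by nlinarith [sq_nonneg a, sq_nonneg b]
      have hb : b = 0 := by nlinarith [sq_nonneg a, sq_nonneg b]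
      refine ⟨fun _ => 1, fun hh => one_ne_zero (congrFun hh (0, 0)), ?_⟩
      rw [flux_aux_mulVec]
      subst ha hb
      rw [← h0]
      funext p
      simp
    · refine ⟨fun p => if p = (0, 0) then (s : ℂ) else if p = (0, 1) then (b : ℂ)
        else if p = (1, 1) then a * Complex.I else 0, fun hh => ?_, ?_⟩
      · have := congrFun hh (0, 0)
        simp at this
        exact h0.ne' this
      · rw [flux_aux_mulVec]
        have hc : (s : ℂ) ^ 2 = a ^ 2 + b ^ 2 := by exact_mod_cast h
        funext ⟨i, j⟩
        fin_cases i <;> fin_cases j <;> simp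
        · linear_combination hc + (a : ℂ) ^ 2 * Complex.I_sq
        all_goals ring
end

section
/- Extracting a proper propagation term from the residual FLUX operator (core of Lemma l:decompose, case t ∈ P): Let a, b ≥ 0 with a² + b² > 0, let X be the Pauli matrix [[0,1],[1,0]], and define the unitary U(a,b) := (a·(iX) + b·I₂)/√(a² + b²). Let F := I₄ − U(a,b) ⊗ E₁₀ − U(a,b)† ⊗ E₀₁ be the Feynman–Kitaev propagation term for U(a,b) on ℂ² ⊗ ℂ², and let G(a,b) := a·h(iX) + b·h(I₂). Then for every δ with 0 ≤ δ ≤ √(a² + b²), the matrix G(a,b) − δ·F is positive semidefinite. -/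
open scoped Matrix Kronecker ComplexOrder

/-- The interpolated proof gate `U(a,b) := (a·(iX) + b·I)/√(a² + b²)`. -/
noncomputable def Uab (a b : ℝ) : Matrix (Fin 2) (Fin 2) ℂ :=
  ((Real.sqrt (a ^ 2 + b ^ 2) : ℂ))⁻¹ •
    ((a : ℂ) • (Complex.I • pauliX) + (b : ℂ) • (1 : Matrix (Fin 2) (Fin 2) ℂ))

theorem flux_aux_psd (W : Matrix (Fin 2) (Fin 2) ℂ) (hW : W * Wᴴ = 1) :
    (fluxH W).PosSemidef := by
  have h : fluxH W = ((1 : Matrix (Fin 2) (Fin 2) ℂ) ⊗ₖ Matrix.single 0 0 (1:ℂ) - W ⊗ₖ E10) *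
      ((1 : Matrix (Fin 2) (Fin 2) ℂ) ⊗ₖ Matrix.single 0 0 (1:ℂ) - W ⊗ₖ E10)ᴴ := by
    have h1 : (1 : Matrix (Fin 2 × Fin 2) (Fin 2 × Fin 2) ℂ) =
        (1 : Matrix (Fin 2) (Fin 2) ℂ) ⊗ₖ Matrix.single 0 0 (1:ℂ) +
        (1 : Matrix (Fin 2) (Fin 2) ℂ) ⊗ₖ Matrix.single 1 1 (1:ℂ) := by
      rw [← Matrix.kronecker_add, ← Matrix.one_kronecker_one]
      congr 1
      ext i j
      fin_cases i <;> fin_cases j <;> simp [Matrix.single]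
    rw [Matrix.conjTranspose_sub, Matrix.conjTranspose_kronecker, Matrix.conjTranspose_kronecker,
      Matrix.sub_mul, Matrix.mul_sub, Matrix.mul_sub, ← Matrix.mul_kronecker_mul,
      ← Matrix.mul_kronecker_mul, ← Matrix.mul_kronecker_mul, ← Matrix.mul_kronecker_mul, hW,
      fluxH, h1]
    simp [E10, E01]
    abel
  rw [h]
  exact Matrix.posSemidef_self_mul_conjTranspose _

theorem flux_aux_unitary (a b : ℝ) (hab : 0 < a ^ 2 + b ^ 2) : Uab a b * (Uab a b)ᴴ = 1 := by
  have hr : (Real.sqrt (a ^ 2 + b ^ 2) : ℂ) ≠ 0 := by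
    exact_mod_cast (Real.sqrt_pos.mpr hab).ne'
  have hr2 : (Real.sqrt (a ^ 2 + b ^ 2) : ℂ) ^ 2 = (a:ℂ) ^ 2 + (b:ℂ) ^ 2 := by
    exact_mod_cast Real.sq_sqrt hab.le
  unfold Uab
  generalize hs : Real.sqrt (a ^ 2 + b ^ 2) = r at *
  ext i j
  fin_cases i <;> fin_cases j <;>
    simp [pauliX, Matrix.mul_apply, Fin.sum_univ_two] <;> field_simp <;>
    simp [hr2] <;> ring

/-- **Extracting a proper propagation term from the residual FLUX operator**
(core of Lemma `l:decompose`, case `t ∈ P`). -/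
theorem flux_extract_propagation (a b : ℝ) (ha : 0 ≤ a) (hb : 0 ≤ b)
    (hab : 0 < a ^ 2 + b ^ 2) (δ : ℝ) (hδ0 : 0 ≤ δ)
    (hδ : δ ≤ Real.sqrt (a ^ 2 + b ^ 2)) :
    (((a : ℂ) • fluxH (Complex.I • pauliX) + (b : ℂ) • fluxH 1) -
      (δ : ℂ) • ((1 : Matrix (Fin 2 × Fin 2) (Fin 2 × Fin 2) ℂ) -
        Uab a b ⊗ₖ E10 - (Uab a b)ᴴ ⊗ₖ E01)).PosSemidef := by
  have hr0 := Real.sqrt_pos.mpr hab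
  have hle : Real.sqrt (a ^ 2 + b ^ 2) ≤ a + b := by
    rw [Real.sqrt_le_left (by positivity)]
    nlinarith [mul_nonneg ha hb]
  have hF := flux_aux_psd _ (flux_aux_unitary a b hab)
  have hU : (a : ℂ) • (Complex.I • pauliX) + (b : ℂ) • (1 : Matrix (Fin 2) (Fin 2) ℂ) =
      (Real.sqrt (a ^ 2 + b ^ 2) : ℂ) • Uab a b := by
    rw [Uab, smul_inv_smul₀ (by exact_mod_cast hr0.ne')]
  have hG : (a : ℂ) • fluxH (Complex.I • pauliX) + (b : ℂ) • fluxH 1 =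
      ((a:ℂ) + b) • (1 : Matrix (Fin 2 × Fin 2) (Fin 2 × Fin 2) ℂ) -
      ((a : ℂ) • (Complex.I • pauliX) + (b : ℂ) • (1 : Matrix (Fin 2) (Fin 2) ℂ)) ⊗ₖ E10 -
      ((a : ℂ) • (Complex.I • pauliX) + (b : ℂ) • (1 : Matrix (Fin 2) (Fin 2) ℂ))ᴴ ⊗ₖ E01 := by
    simp only [fluxH, Matrix.conjTranspose_add, Matrix.conjTranspose_smul (a:ℂ),
      Matrix.conjTranspose_smul (b:ℂ), Matrix.add_kronecker,
      Matrix.smul_kronecker (a:ℂ), Matrix.smul_kronecker (b:ℂ), Complex.star_def,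
      Complex.conj_ofReal]
    module
  have key : ((a : ℂ) • fluxH (Complex.I • pauliX) + (b : ℂ) • fluxH 1) -
      (δ : ℂ) • ((1 : Matrix (Fin 2 × Fin 2) (Fin 2 × Fin 2) ℂ) -
        Uab a b ⊗ₖ E10 - (Uab a b)ᴴ ⊗ₖ E01) =
      ((a + b - Real.sqrt (a ^ 2 + b ^ 2) : ℝ) : ℂ) • 1 +
      ((Real.sqrt (a ^ 2 + b ^ 2) - δ : ℝ) : ℂ) • fluxH (Uab a b) := by
    rw [hG, hU]
    simp only [fluxH, Matrix.conjTranspose_smul, Matrix.smul_kronecker, Complex.star_def,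
      Complex.conj_ofReal]
    push_cast
    module
  rw [key]
  refine (Matrix.PosSemidef.one.smul ?_).add (hF.smul ?_)
  · exact_mod_cast sub_nonneg.mpr hle
  · exact_mod_cast sub_nonneg.mpr hδ
end

section
/- ℓ₁ bound on Pauli coefficients (used in the proof of Lemma lem:pauli-based-decomp): Let n ≥ 1, d = 2^n, and let H be a d×d Hermitian matrix. For each σ : Fin n → Fin 4 define α_σ := Tr(P(σ)·H)/d, where P(σ) is the Pauli string of σ. Then each α_σ is real with |α_σ| ≤ ‖H‖, and Σ_σ |α_σ| ≤ d·‖H‖, where ‖H‖ is the spectral norm and the sum ranges over all 4^n functions σ. -/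
open scoped Matrix Matrix.Norms.L2Operator

/-- The Pauli coefficient `α_σ := Tr(P(σ)·H)/d` of a Hamiltonian on `n` qubits. -/
noncomputable def pauliCoeff {n : ℕ} (H : Matrix (Fin n → Fin 2) (Fin n → Fin 2) ℂ)
    (σ : Fin n → Fin 4) : ℂ :=
  (pauliString σ * H).trace / ((2 : ℂ) ^ n)

theorem pauli_orth (x y x' y' : Fin 2) :
    ∑ a : Fin 4, pauli a x y * star (pauli a x' y') =
      if x = x' ∧ y = y' then (2 : ℂ) else 0 := by
  fin_cases x <;> fin_cases y <;> fin_cases x' <;> fin_cases y' <;>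
    simp [Fin.sum_univ_four, pauli] <;> norm_num

theorem pauli_herm (a : Fin 4) (x y : Fin 2) : star (pauli a x y) = pauli a y x := by
  fin_cases a <;> fin_cases x <;> fin_cases y <;> simp [pauli]

theorem pauliString_orth {n : ℕ} (z w : (Fin n → Fin 2) × (Fin n → Fin 2)) :
    ∑ σ : Fin n → Fin 4, pauliString σ z.1 z.2 * star (pauliString σ w.1 w.2) =
      if z = w then (2 : ℂ) ^ n else 0 := by
  have h : ∀ σ : Fin n → Fin 4, pauliString σ z.1 z.2 * star (pauliString σ w.1 w.2) =
      ∏ k, pauli (σ k) (z.1 k) (z.2 k) * star (pauli (σ k) (w.1 k) (w.2 k)) := by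
    intro σ
    simp [pauliString, Finset.prod_mul_distrib]
  simp_rw [h]
  rw [← Fintype.prod_sum
    (fun k a => pauli a (z.1 k) (z.2 k) * star (pauli a (w.1 k) (w.2 k)))]
  simp_rw [pauli_orth]
  split_ifs with hz
  · subst hz
    simp
  · have : ∃ k, ¬ (z.1 k = w.1 k ∧ z.2 k = w.2 k) := by
      by_contra hc
      push Not at hc
      exact hz (Prod.ext (funext fun k => (hc k).1) (funext fun k => (hc k).2))
    obtain ⟨k, hk⟩ := this
    exact Finset.prod_eq_zero (Finset.mem_univ k) (if_neg hk)

theorem pauli_trace {n : ℕ} (H : Matrix (Fin n → Fin 2) (Fin n → Fin 2) ℂ)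
    (σ : Fin n → Fin 4) : (pauliString σ * H).trace =
      ∑ z : (Fin n → Fin 2) × (Fin n → Fin 2), pauliString σ z.1 z.2 * H z.2 z.1 := by
  simp [Matrix.trace, Matrix.mul_apply, Fintype.sum_prod_type]

theorem pauli_parseval {n : ℕ} (H : Matrix (Fin n → Fin 2) (Fin n → Fin 2) ℂ) :
    ∑ σ : Fin n → Fin 4, ‖(pauliString σ * H).trace‖ ^ 2 =
      2 ^ n * ∑ z : (Fin n → Fin 2) × (Fin n → Fin 2), ‖H z.2 z.1‖ ^ 2 := by
  have key : ∀ c : ℂ, ((‖c‖ ^ 2 : ℝ) : ℂ) = c * star c := by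
    intro c
    simpa using (Complex.mul_conj' c).symm
  apply Complex.ofReal_injective
  rw [Complex.ofReal_sum, Complex.ofReal_mul, Complex.ofReal_sum]
  simp_rw [key, pauli_trace, star_sum, Finset.sum_mul_sum]
  rw [Finset.sum_comm, Finset.mul_sum]
  refine Finset.sum_congr rfl fun z _ => ?_
  rw [Finset.sum_comm]
  have : ∀ w : (Fin n → Fin 2) × (Fin n → Fin 2),
      ∑ σ : Fin n → Fin 4, pauliString σ z.1 z.2 * H z.2 z.1 *
        star (pauliString σ w.1 w.2 * H w.2 w.1) =
      (if z = w then (2 : ℂ) ^ n else 0) * (H z.2 z.1 * star (H w.2 w.1)) := by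
    intro w
    rw [← pauliString_orth, Finset.sum_mul]
    refine Finset.sum_congr rfl fun σ _ => ?_
    rw [star_mul']
    ring
  simp_rw [this]
  simp

theorem frob_le {n : ℕ} (H : Matrix (Fin n → Fin 2) (Fin n → Fin 2) ℂ) :
    ∑ z : (Fin n → Fin 2) × (Fin n → Fin 2), ‖H z.2 z.1‖ ^ 2 ≤ 2 ^ n * ‖H‖ ^ 2 := by
  rw [Fintype.sum_prod_type]
  have h : ∀ x : Fin n → Fin 2, ∑ y, ‖H y x‖ ^ 2 ≤ ‖H‖ ^ 2 := by
    intro x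
    have h1 := Matrix.l2_opNorm_mulVec H (EuclideanSpace.single x (1 : ℂ))
    rw [EuclideanSpace.norm_single, norm_one, mul_one] at h1
    have h2 := pow_le_pow_left₀ (norm_nonneg _) h1 2
    rw [EuclideanSpace.norm_sq_eq] at h2
    simpa using h2
  calc _ ≤ ∑ x : Fin n → Fin 2, ‖H‖ ^ 2 := Finset.sum_le_sum fun x _ => h x
    _ = _ := by simp

theorem coeff_sq_le {n : ℕ} (H : Matrix (Fin n → Fin 2) (Fin n → Fin 2) ℂ) :
    ∑ σ : Fin n → Fin 4, ‖pauliCoeff H σ‖ ^ 2 ≤ ‖H‖ ^ 2 := by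
  have h : ∀ σ : Fin n → Fin 4, ‖pauliCoeff H σ‖ ^ 2 =
      ‖(pauliString σ * H).trace‖ ^ 2 / (2 ^ n * 2 ^ n) := by
    intro σ
    simp only [pauliCoeff, norm_div, norm_pow, Complex.norm_ofNat]
    ring
  simp_rw [h]
  rw [← Finset.sum_div, pauli_parseval, div_le_iff₀ (by positivity)]
  calc _ ≤ (2 : ℝ) ^ n * (2 ^ n * ‖H‖ ^ 2) := by gcongr; exact frob_le H
    _ = _ := by ring

theorem le_of_sq_le_sq_aux {a b : ℝ} (h : a ^ 2 ≤ b ^ 2) (hb : 0 ≤ b) : a ≤ b :=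
  abs_le_of_sq_le_sq' h hb |>.2

/-- **ℓ₁ bound on Pauli coefficients** (used in the proof of Lemma
`lem:pauli-based-decomp`): each `α_σ` is real with `|α_σ| ≤ ‖H‖`, and
`Σ_σ |α_σ| ≤ d·‖H‖` in spectral norm. -/
theorem pauli_coeff_l1_bound {n : ℕ} (hn : 1 ≤ n)
    (H : Matrix (Fin n → Fin 2) (Fin n → Fin 2) ℂ) (hH : H.IsHermitian) :
    (∀ σ : Fin n → Fin 4, (pauliCoeff H σ).im = 0 ∧ ‖pauliCoeff H σ‖ ≤ ‖H‖) ∧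
    (∑ σ : Fin n → Fin 4, ‖pauliCoeff H σ‖) ≤ (2 : ℝ) ^ n * ‖H‖ := by
  refine ⟨fun σ => ⟨?_, ?_⟩, ?_⟩
  · rw [← Complex.conj_eq_iff_im, pauliCoeff, map_div₀, map_pow]
    have h2 : (starRingEnd ℂ) 2 = 2 := Complex.conj_ofNat 2
    have hP : (pauliString σ)ᴴ = pauliString σ := by
      ext x y
      rw [Matrix.conjTranspose_apply]
      simp only [pauliString, Matrix.of_apply, star_prod, pauli_herm]
    rw [h2, starRingEnd_apply, ← Matrix.trace_conjTranspose, Matrix.conjTranspose_mul, hP,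
      hH.eq, Matrix.trace_mul_comm]
  · refine le_of_sq_le_sq_aux ?_ (norm_nonneg _)
    exact (Finset.single_le_sum (f := fun σ => ‖pauliCoeff H σ‖ ^ 2)
      (fun _ _ => by positivity) (Finset.mem_univ σ)).trans (coeff_sq_le H)
  · refine le_of_sq_le_sq_aux ?_ (by positivity)
    have hc := sq_sum_le_card_mul_sum_sq (s := (Finset.univ : Finset (Fin n → Fin 4)))
      (f := fun σ => ‖pauliCoeff H σ‖)
    refine hc.trans ?_
    have h4 : (4 : ℝ) ^ n = (2 ^ n) ^ 2 := by
      rw [← pow_mul, mul_comm, pow_mul]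
      norm_num
    rw [mul_pow, ← h4]
    simp only [Finset.card_univ, Fintype.card_fun, Fintype.card_fin, Nat.cast_pow,
      Nat.cast_ofNat]
    gcongr
    exact coeff_sq_le H
end

section
/- Rotation between unit vectors with small Hamiltonian (step in the proof of Lemma lem:map-close-vectors): Let d ≥ 1 and let ψ, φ ∈ ℂ^d be unit vectors, and set θ := arccos(Re⟨ψ, φ⟩) ∈ [0, π]. Then there exists a d×d Hermitian matrix H with spectral norm ‖H‖ ≤ θ such that exp(iH)·ψ = φ. -/
open scoped Matrix Matrix.Norms.L2Operator

open scoped ComplexOrder in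
lemma dot_zero {d : ℕ} (u : Fin d → ℂ) (h : star u ⬝ᵥ u = 0) : u = 0 :=
  dotProduct_star_self_eq_zero.1 h

open scoped ComplexOrder in
lemma dot_nonneg {d : ℕ} (u : Fin d → ℂ) : 0 ≤ (star u ⬝ᵥ u).re := by
  have h := dotProduct_star_self_nonneg u
  exact (Complex.le_def.1 h).1

lemma exp_involution {d : ℕ} (K : Matrix (Fin d) (Fin d) ℂ) (hK : K * K = 1) (z : ℂ) :
    NormedSpace.exp (z • K) = Complex.exp z • ((1/2 : ℂ) • (1 + K))
      + Complex.exp (-z) • ((1/2 : ℂ) • (1 - K)) := by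
  have hpow : ∀ n : ℕ, K ^ n = ((1/2 : ℂ) • (1 + K)) + ((-1 : ℂ) ^ n) • ((1/2 : ℂ) • (1 - K)) := by
    intro n
    induction n with
    | zero => simp only [pow_zero]; module
    | succ n ih =>
      rw [pow_succ, ih]
      simp only [add_mul, smul_mul_assoc, sub_mul, one_mul, hK, pow_succ]
      module
  have h1 := NormedSpace.exp_series_hasSum_exp' (𝕂 := ℂ) (z • K)
  have h2 := NormedSpace.exp_series_hasSum_exp' (𝕂 := ℂ) z
  have h3 := NormedSpace.exp_series_hasSum_exp' (𝕂 := ℂ) (-z)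
  rw [← Complex.exp_eq_exp_ℂ] at h2 h3
  have h4 := (h2.smul_const ((1/2 : ℂ) • (1 + K))).add (h3.smul_const ((1/2 : ℂ) • (1 - K)))
  have hf : (fun n : ℕ => ((n.factorial : ℂ)⁻¹) • (z • K) ^ n) = fun n : ℕ =>
      (((n.factorial : ℂ)⁻¹) • z ^ n) • ((1/2 : ℂ) • (1 + K))
        + (((n.factorial : ℂ)⁻¹) • (-z) ^ n) • ((1/2 : ℂ) • (1 - K)) := by
    funext n
    rw [smul_pow, hpow, neg_pow]
    simp only [smul_eq_mul]
    module
  rw [hf] at h1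
  exact h1.unique h4

lemma exp_I_involution {d : ℕ} (K : Matrix (Fin d) (Fin d) ℂ) (hK : K * K = 1) (t : ℝ) :
    NormedSpace.exp (Complex.I • ((t : ℂ) • K)) = (Real.cos t : ℂ) • 1
      + (Complex.I * (Real.sin t : ℂ)) • K := by
  rw [smul_smul, exp_involution K hK, mul_comm Complex.I (t : ℂ), ← neg_mul,
    Complex.exp_mul_I, Complex.exp_mul_I, Complex.cos_neg, Complex.sin_neg,
    Complex.ofReal_cos, Complex.ofReal_sin]
  module

lemma ip_eq {d : ℕ} (u v : Fin d → ℂ) : ip u v = star u ⬝ᵥ v := rfl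

lemma ip_self_of_unit {d : ℕ} (u : Fin d → ℂ) (h : _root_.enorm u = 1) : star u ⬝ᵥ u = 1 := by
  rw [_root_.enorm, Real.sqrt_eq_one] at h
  have : star u ⬝ᵥ u = ((∑ i, ‖u i‖ ^ 2 : ℝ) : ℂ) := by
    push_cast
    refine Finset.sum_congr rfl fun i _ => ?_
    exact Complex.conj_mul' (u i)
  rw [this, h]; simp

lemma reflection_exists {d : ℕ} (ψ χ : Fin d → ℂ) (h1 : star ψ ⬝ᵥ ψ = 1) (h2 : star χ ⬝ᵥ χ = 1)
    (h3 : star ψ ⬝ᵥ χ = star χ ⬝ᵥ ψ) :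
    ∃ K : Matrix (Fin d) (Fin d) ℂ, K.IsHermitian ∧ K * K = 1 ∧ K *ᵥ ψ = χ := by
  by_cases hv : ψ = χ
  · exact ⟨1, Matrix.isHermitian_one, by simp, by simp [hv]⟩
  obtain ⟨v, hvdef⟩ : ∃ v, v = ψ - χ := ⟨_, rfl⟩
  have hv0 : v ≠ 0 := by rw [hvdef]; exact sub_ne_zero.2 hv
  have hN : star v ⬝ᵥ v ≠ 0 := by
    intro h; exact hv0 (dot_zero v h)
  obtain ⟨N, hNd⟩ : ∃ N, N = star v ⬝ᵥ v := ⟨_, rfl⟩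
  rw [← hNd] at hN
  have hNs : star N = N := by
    rw [hNd, ← Matrix.star_dotProduct_star, star_star, dotProduct_comm]
  have hN2 : N = 2 * (star v ⬝ᵥ ψ) := by
    rw [hNd, hvdef]
    simp only [star_sub, sub_dotProduct, dotProduct_sub, h1, h2, h3]; ring
  refine ⟨1 - (2 / N) • Matrix.vecMulVec v (star v), ?_, ?_, ?_⟩
  · have hs : star (2 / N) = 2 / N := by
      rw [star_div₀, hNs]; simp
    simp only [Matrix.IsHermitian, Matrix.conjTranspose_sub, Matrix.conjTranspose_one,
      Matrix.conjTranspose_smul, Matrix.conjTranspose_vecMulVec, star_star, hs]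
  · have : Matrix.vecMulVec v (star v) * Matrix.vecMulVec v (star v)
        = N • Matrix.vecMulVec v (star v) := by
      rw [Matrix.vecMulVec_mul_vecMulVec, ← hNd, Matrix.vecMulVec_smul]
    simp only [sub_mul, mul_sub, one_mul, mul_one, smul_mul_assoc, mul_smul_comm, this, smul_smul,
      smul_sub]
    have e : 2 / N * (2 / N * N) = 2 * (2 / N) := by field_simp
    rw [e]; module
  · rw [Matrix.sub_mulVec, Matrix.one_mulVec, Matrix.smul_mulVec, Matrix.vecMulVec_mulVec]
    have e : 2 / N * (star v ⬝ᵥ ψ) = 1 := by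
      field_simp; rw [hN2]
    ext i
    have := congrArg (· * v i) e
    simp only [one_mul] at this
    simp only [Pi.sub_apply, Pi.smul_apply, smul_eq_mul, MulOpposite.smul_eq_mul_unop,
      MulOpposite.unop_op]
    rw [mul_comm (v i), ← mul_assoc, this, hvdef]
    simp

lemma chi_exists {d : ℕ} (ψ φ : Fin d → ℂ) (h1 : star ψ ⬝ᵥ ψ = 1) (h2 : star φ ⬝ᵥ φ = 1)
    (c s : ℝ) (hc : (star ψ ⬝ᵥ φ).re = c) (hs : c ^ 2 + s ^ 2 = 1) :
    ∃ χ : Fin d → ℂ, star χ ⬝ᵥ χ = 1 ∧ star ψ ⬝ᵥ χ = star χ ⬝ᵥ ψ ∧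
      φ = (c : ℂ) • ψ + (Complex.I * (s : ℂ)) • χ := by
  have hconj : star φ ⬝ᵥ ψ = star (star ψ ⬝ᵥ φ) := by
    rw [← Matrix.star_dotProduct_star, star_star, dotProduct_comm]
  have hsum : star ψ ⬝ᵥ φ + star φ ⬝ᵥ ψ = 2 * (c : ℂ) := by
    rw [hconj]
    apply Complex.ext <;> simp [hc]; ring
  have hsC : (c : ℂ) ^ 2 + (s : ℂ) ^ 2 = 1 := by exact_mod_cast hs
  have hnorm : star (φ - (c : ℂ) • ψ) ⬝ᵥ (φ - (c : ℂ) • ψ) = (s : ℂ) ^ 2 := by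
    have hcs : star (c : ℂ) = (c : ℂ) := Complex.conj_ofReal c
    simp only [star_sub, star_smul, hcs, sub_dotProduct, dotProduct_sub, smul_dotProduct,
      dotProduct_smul, smul_eq_mul, h1, h2]
    linear_combination (-(c : ℂ)) * hsum - hsC
  by_cases h0 : s = 0
  · refine ⟨ψ, h1, rfl, ?_⟩
    rw [h0] at hnorm ⊢
    have : φ - (c : ℂ) • ψ = 0 :=
      dot_zero _ (by rw [hnorm]; simp)
    rw [sub_eq_zero.1 this]; simp
  · have h0' : (s : ℂ) ≠ 0 := by exact_mod_cast h0
    have hI : Complex.I * Complex.I = -1 := Complex.I_mul_I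
    have hst : star (-(Complex.I) / (s : ℂ)) = Complex.I / (s : ℂ) := by
      rw [star_div₀]; simp
    refine ⟨(-(Complex.I) / (s : ℂ)) • (φ - (c : ℂ) • ψ), ?_, ?_, ?_⟩
    · rw [star_smul, smul_dotProduct, dotProduct_smul, hnorm, hst]
      simp only [smul_eq_mul]
      field_simp
      linear_combination -hI
    · have hcs : star (c : ℂ) = (c : ℂ) := Complex.conj_ofReal c
      rw [star_smul, smul_dotProduct, dotProduct_smul, hst]
      simp only [star_sub, star_smul, hcs, sub_dotProduct, dotProduct_sub, smul_dotProduct,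
        dotProduct_smul, smul_eq_mul, h1]
      linear_combination (-Complex.I / s) * hsum
    · have : Complex.I * (s : ℂ) * (-(Complex.I) / (s : ℂ)) = 1 := by
        field_simp; linear_combination -hI
      rw [smul_smul, this]; module

/-- **Rotation between unit vectors with small Hamiltonian** (step in the proof of
Lemma `lem:map-close-vectors`). -/
theorem rotation_small_hamiltonian {d : ℕ} (hd : 1 ≤ d) (ψ φ : Fin d → ℂ)
    (hψ : _root_.enorm ψ = 1) (hφ : _root_.enorm φ = 1) :
    ∃ H : Matrix (Fin d) (Fin d) ℂ, H.IsHermitian ∧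
      ‖H‖ ≤ Real.arccos (ip ψ φ).re ∧
      (NormedSpace.exp (Complex.I • H)).mulVec ψ = φ := by
  have h1 := ip_self_of_unit ψ hψ
  have h2 := ip_self_of_unit φ hφ
  rw [ip_eq]
  obtain ⟨c, hc⟩ : ∃ c, (star ψ ⬝ᵥ φ).re = c := ⟨_, rfl⟩
  have hconj : star φ ⬝ᵥ ψ = star (star ψ ⬝ᵥ φ) := by
    rw [← Matrix.star_dotProduct_star, star_star, dotProduct_comm]
  have hsum : star ψ ⬝ᵥ φ + star φ ⬝ᵥ ψ = 2 * (c : ℂ) := by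
    rw [hconj]
    apply Complex.ext <;> simp [hc]; ring
  have hb1 : c ≤ 1 := by
    have h := dot_nonneg (φ - ψ)
    have e : star (φ - ψ) ⬝ᵥ (φ - ψ) = ((2 - 2 * c : ℝ) : ℂ) := by
      simp only [star_sub, sub_dotProduct, dotProduct_sub, h1, h2]
      push_cast
      linear_combination -hsum
    rw [e, Complex.ofReal_re] at h
    linarith
  have hb2 : -1 ≤ c := by
    have h := dot_nonneg (φ + ψ)
    have e : star (φ + ψ) ⬝ᵥ (φ + ψ) = ((2 + 2 * c : ℝ) : ℂ) := by
      simp only [star_add, add_dotProduct, dotProduct_add, h1, h2]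
      push_cast
      linear_combination hsum
    rw [e, Complex.ofReal_re] at h
    linarith
  have hcos := Real.cos_arccos hb2 hb1
  rw [hc]
  obtain ⟨χ, g1, g2, g3⟩ := chi_exists ψ φ h1 h2 c (Real.sin (Real.arccos c)) hc (by
    have := Real.cos_sq_add_sin_sq (Real.arccos c)
    rwa [hcos] at this)
  obtain ⟨K, k1, k2, k3⟩ := reflection_exists ψ χ h1 g1 g2
  have : Nonempty (Fin d) := ⟨⟨0, hd⟩⟩
  have hKn : ‖K‖ = 1 := by
    have h := CStarRing.norm_star_mul_self (x := K)
    rw [Matrix.star_eq_conjTranspose, k1.eq, k2, CStarRing.norm_one] at h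
    nlinarith [norm_nonneg K]
  refine ⟨(Real.arccos c : ℂ) • K, ?_, ?_, ?_⟩
  · have hst : star (Real.arccos c : ℂ) = (Real.arccos c : ℂ) := Complex.conj_ofReal _
    rw [Matrix.IsHermitian, Matrix.conjTranspose_smul, k1.eq, hst]
  · rw [norm_smul, hKn, mul_one, Complex.norm_real, Real.norm_of_nonneg (Real.arccos_nonneg c)]
  · rw [exp_I_involution K k2, hcos, Matrix.add_mulVec, Matrix.smul_mulVec, Matrix.smul_mulVec,
      Matrix.one_mulVec, k3]
    exact g3.symm
end
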